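/- There is no field automorphism of order 3 of an algebraically closed field. More generally, by the Artin–Schreier theorem, any finite subgroup of the automorphism group of an algebraically closed field has order 1 or 2. -/

import Mathlib

theorem aux_dedekind {L : Type*} [Field L] (σ : L ≃+* L) (p : ℕ) (hp : orderOf σ = p)
    (c : ℕ → L) (h : ∀ x, ∑ k ∈ Finset.range p, c k * (σ ^ k) x = 0) :
    ∀ k < p, c k = 0 := by
  have li := linearIndependent_monoidHom L L
  have inj : Function.Injective (fun k : Fin p => ((((σ ^ (k : ℕ) : L ≃+* L) : L →+* L)) : L →* L)) := by
    intro a b hab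
    have h1 : σ ^ (a : ℕ) = σ ^ (b : ℕ) := by
      ext x
      exact DFunLike.congr_fun hab x
    have := pow_injOn_Iio_orderOf (x := σ) (by simp [hp]) (by simp [hp]) h1
    exact Fin.ext this
  have li2 := li.comp _ inj
  rw [Fintype.linearIndependent_iff] at li2
  intro k hk
  refine li2 (fun k => c k) ?_ ⟨k, hk⟩
  ext x
  have := h x
  rw [Finset.sum_range] at this
  simpa [Finset.sum_apply] using this

theorem aux_shift {L : Type*} [Field L] (f : ℕ → L) (p : ℕ) :
    ∑ k ∈ Finset.range p, f (k + 1) = ∑ k ∈ Finset.range p, f k + f p - f 0 := by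
  have h1 := Finset.sum_range_succ f p
  have h2 := Finset.sum_range_succ' f p
  rw [← h1, h2]; ring

theorem aux_pow {L : Type*} [Field L] (σ : L ≃+* L) (k : ℕ) (x : L) :
    σ ((σ ^ k) x) = (σ ^ (k + 1)) x := by
  rw [pow_succ']; rfl

theorem aux_charp {L : Type*} [Field L] [IsAlgClosed L] (σ : L ≃+* L) (p : ℕ)
    (hpp : p.Prime) (hp : orderOf σ = p) [CharP L p] : False := by
  haveI : Fact p.Prime := ⟨hpp⟩
  have hσp : σ ^ p = 1 := hp ▸ pow_orderOf_eq_one σ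
  have hex : ∃ x, ∑ k ∈ Finset.range p, (σ ^ k) x ≠ 0 := by
    by_contra! hcon
    exact one_ne_zero (aux_dedekind σ p hp (fun _ => (1 : L)) (by simpa using hcon) 0 hpp.pos)
  obtain ⟨x, hx⟩ := hex
  have fixT : ∀ x, σ (∑ k ∈ Finset.range p, (σ ^ k) x) = ∑ k ∈ Finset.range p, (σ ^ k) x := by
    intro x
    rw [map_sum]
    simp only [aux_pow]
    rw [aux_shift (fun k => (σ ^ k) x)]
    simp [hσp]
  have fixpow : ∀ a, σ a = a → ∀ k : ℕ, (σ ^ k) a = a := by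
    intro a ha k
    induction k with
    | zero => simp
    | succ k ih => rw [← aux_pow, ih, ha]
  set t := ∑ k ∈ Finset.range p, (σ ^ k) x with ht
  have tsurj : ∀ a, σ a = a → ∃ b, ∑ k ∈ Finset.range p, (σ ^ k) b = a := by
    intro a ha
    refine ⟨a / t * x, ?_⟩
    have h1 : σ (a / t) = a / t := by rw [map_div₀, ha, fixT]
    simp only [map_mul, fixpow _ h1]
    rw [← Finset.mul_sum, ← ht]
    field_simp
  have pfix : ∀ a, σ a = a → ∃ k, σ k = k ∧ k ^ p - k = a := by
    intro a ha
    obtain ⟨b, hb⟩ := tsurj a ha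
    have hdeg : (Polynomial.X ^ p - Polynomial.X - Polynomial.C b : Polynomial L).degree ≠ 0 := by
      have : (Polynomial.X ^ p - Polynomial.X - Polynomial.C b : Polynomial L).degree = p := by
        have h1 : (1 : WithBot ℕ) < (p : WithBot ℕ) := by exact_mod_cast hpp.one_lt
        rw [sub_sub, Polynomial.degree_sub_eq_left_of_degree_lt, Polynomial.degree_X_pow]
        rw [Polynomial.degree_X_pow, Polynomial.degree_X_add_C]
        exact h1
      rw [this]
      exact_mod_cast hpp.ne_zero
    obtain ⟨c, hc⟩ := IsAlgClosed.exists_root _ hdeg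
    have hc : c ^ p - c = b := by
      simpa [Polynomial.IsRoot, sub_eq_zero] using hc
    refine ⟨∑ k ∈ Finset.range p, (σ ^ k) c, fixT c, ?_⟩
    rw [← hb, ← hc, sum_pow_char]
    simp
  obtain ⟨b, hb⟩ := tsurj 1 (map_one σ)
  obtain ⟨y, hy⟩ : ∃ y, σ y = y + 1 := by
    refine ⟨-∑ k ∈ Finset.range p, (k : L) * (σ ^ k) b, ?_⟩
    have h1 : σ (∑ k ∈ Finset.range p, (k : L) * (σ ^ k) b)
        = ∑ k ∈ Finset.range p, (((k + 1 : ℕ) : L) * (σ ^ (k + 1)) b)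
          - ∑ k ∈ Finset.range p, (σ ^ (k + 1)) b := by
      rw [map_sum, ← Finset.sum_sub_distrib]
      refine Finset.sum_congr rfl fun k _ => ?_
      rw [map_mul, aux_pow, map_natCast]
      push_cast; ring
    rw [map_neg, h1, aux_shift (fun k => (k : L) * (σ ^ k) b), aux_shift (fun k => (σ ^ k) b), hb]
    simp [hσp]
    ring
  obtain ⟨k, hk, hk2⟩ := pfix (y ^ p - y) (by
    rw [map_sub, map_pow, hy, add_pow_char]; ring)
  have hd : (y - k) ^ p = y - k := by
    rw [sub_pow_char]; linear_combination -hk2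
  have hm := (Subfield.mem_bot_iff_pow_eq_self (F := L) (p := p)).2 hd
  have : σ (y - k) = y - k := by
    rw [← ZMod.fieldRange_castHom_eq_bot p] at hm
    obtain ⟨n, hn⟩ := hm
    rw [← hn]
    exact DFunLike.congr_fun (Subsingleton.elim ((σ : L →+* L).comp (ZMod.castHom dvd_rfl L)) (ZMod.castHom dvd_rfl L)) n
  rw [map_sub, hy, hk] at this
  exact one_ne_zero (α := L) (by linear_combination this)

theorem aux_not_charp {L : Type*} [Field L] [IsAlgClosed L] (σ : L ≃+* L) (p : ℕ)
    (hpp : p.Prime) (hp : orderOf σ = p) (hne : (p : L) ≠ 0) (i : L) (hi : i ^ 2 = -1)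
    (hσi : σ i = i) : False := by
  have hσp : σ ^ p = 1 := hp ▸ pow_orderOf_eq_one σ
  haveI : NeZero (p : L) := ⟨hne⟩
  haveI : NeZero p := ⟨hpp.ne_zero⟩
  haveI : Fact p.Prime := ⟨hpp⟩
  obtain ⟨ζ, hζ⟩ := HasEnoughRootsOfUnity.exists_primitiveRoot L p
  have hζ0 : ζ ≠ 0 := hζ.ne_zero hpp.ne_zero
  have fixζ : σ ζ = ζ := by
    obtain ⟨a, -, ha⟩ := hζ.eq_pow_of_pow_eq_one (ξ := σ ζ) (by rw [← map_pow, hζ.pow_eq_one, map_one])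
    have h1 : ∀ k : ℕ, (σ ^ k) ζ = ζ ^ (a ^ k) := by
      intro k
      induction k with
      | zero => simp
      | succ k ih => rw [← aux_pow, ih, map_pow, ← ha, ← pow_mul, pow_succ']
    have h2 := h1 p
    rw [hσp] at h2
    have h3 : a ^ p ≡ a [MOD p] := by
      rw [← ZMod.natCast_eq_natCast_iff]
      push_cast
      exact ZMod.pow_card _
    have h4 : ζ ^ (a ^ p) = ζ ^ a := by
      rw [← pow_mod_orderOf, ← pow_mod_orderOf ζ a, ← hζ.eq_orderOf, h3]
    rw [h4, ha] at h2
    exact h2.symm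
  have fixμ : ∀ w : L, w ^ p = 1 → σ w = w := by
    intro w hw
    obtain ⟨a, -, ha⟩ := hζ.eq_pow_of_pow_eq_one hw
    rw [← ha, map_pow, fixζ]
  obtain ⟨x, hx⟩ : ∃ x, ∑ k ∈ Finset.range p, ζ ^ k * (σ ^ k) x ≠ 0 := by
    by_contra! hcon
    have := aux_dedekind σ p hp (fun k => ζ ^ k) hcon 0 hpp.pos
    simp at this
  set y := ∑ k ∈ Finset.range p, ζ ^ k * (σ ^ k) x with hy
  have hσy : ζ * σ y = y := by
    rw [hy, map_sum, Finset.mul_sum]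
    have : ∀ k ∈ Finset.range p, ζ * σ (ζ ^ k * (σ ^ k) x) = ζ ^ (k + 1) * (σ ^ (k + 1)) x := by
      intro k _
      rw [map_mul, aux_pow, map_pow, fixζ]; ring
    rw [Finset.sum_congr rfl this, aux_shift (fun k => ζ ^ k * (σ ^ k) x)]
    simp [hσp, hζ.pow_eq_one]
  obtain ⟨z, hz⟩ := IsAlgClosed.exists_pow_nat_eq y hpp.pos
  have hz0 : z ≠ 0 := by
    rintro rfl
    rw [zero_pow hpp.ne_zero] at hz
    exact hx hz.symm
  have hσz0 : σ z ≠ 0 := by simpa using hz0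
  have hσy0 : σ y ≠ 0 := by simpa using hx
  set u := z / σ z with hu
  have hu0 : u ≠ 0 := div_ne_zero hz0 hσz0
  have hup : u ^ p = ζ := by
    rw [hu, div_pow, ← map_pow, hz, div_eq_iff hσy0, hσy]
  have hprod : ∏ k ∈ Finset.range p, (σ ^ k) u = 1 := by
    have : ∀ k ∈ Finset.range p, (σ ^ k) u = (σ ^ k) z / (σ ^ (k + 1)) z := by
      intro k _
      rw [hu, map_div₀, pow_succ]; rfl
    rw [Finset.prod_congr rfl this]
    have key : ∀ n : ℕ, ∏ k ∈ Finset.range n, (σ ^ k) z / (σ ^ (k + 1)) z = z / (σ ^ n) z := by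
      intro n
      induction n with
      | zero => simp [hz0]
      | succ n ih =>
        have : (σ ^ n) z ≠ 0 := (map_ne_zero_iff _ (σ ^ n).injective).2 hz0
        rw [Finset.prod_range_succ, ih]; field_simp
    rw [key, hσp]
    exact div_self hz0
  set w := σ u / u with hw
  have hwp : w ^ p = 1 := by
    rw [hw, div_pow, ← map_pow, hup, fixζ, div_self hζ0]
  have hσu : σ u = u * w := by rw [hw]; field_simp
  have hσk : ∀ k : ℕ, (σ ^ k) u = u * w ^ k := by
    intro k
    induction k with
    | zero => simp
    | succ k ih => rw [← aux_pow, ih, map_mul, map_pow, fixμ w hwp, hσu]; ring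
  have hw1 : w ^ (∑ k ∈ Finset.range p, k) = 1 := by
    rw [Finset.sum_range_id]
    rcases hpp.eq_two_or_odd' with h2 | hodd
    · have : w = 1 := by
        subst h2
        have hζ' : ζ = -1 := hζ.eq_neg_one_of_two_right
        have : u ^ 2 = i ^ 2 := by rw [hup, hζ', hi]
        have : σ u = u := by
          rcases sq_eq_sq_iff_eq_or_eq_neg.1 this with h | h <;> rw [h] <;> simp [hσi]
        rw [hw, this, div_self hu0]
      rw [this, one_pow]
    · obtain ⟨m, hm⟩ := hodd
      have : p * (p - 1) / 2 = p * m := by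
        rw [Nat.mul_div_assoc]
        · congr 1; omega
        · exact ⟨m, by omega⟩
      rw [this, pow_mul, hwp, one_pow]
  simp only [hσk] at hprod
  rw [Finset.prod_mul_distrib, Finset.prod_const, Finset.card_range, Finset.prod_pow_eq_pow_sum,
    hw1, hup, mul_one] at hprod
  exact hζ.ne_one hpp.one_lt hprod

theorem aux_main {L : Type*} [Field L] [IsAlgClosed L] (σ : L ≃+* L) (hfin : IsOfFinOrder σ)
    (i : L) (hi : i ^ 2 = -1) (hσi : σ i = i) : σ = 1 := by
  by_contra hne
  have h1 : orderOf σ ≠ 1 := by simpa using hne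
  obtain ⟨p, hpp, m, hm⟩ := Nat.exists_prime_and_dvd h1
  have hpos := hfin.orderOf_pos
  have hm0 : m ≠ 0 := by rintro rfl; omega
  have ho : orderOf (σ ^ m) = p := by
    rw [orderOf_pow_of_dvd hm0 ⟨p, by rw [hm, mul_comm]⟩, hm, Nat.mul_div_cancel _ (by omega)]
  have hf : (σ ^ m) i = i := by
    clear hm hm0 ho
    induction m with
    | zero => simp
    | succ k ih => rw [← aux_pow, ih, hσi]
  by_cases hc : (p : L) = 0
  · haveI : CharP L p := by
      haveI : Fact p.Prime := ⟨hpp⟩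
      rw [← CharP.ringChar_of_prime_eq_zero hpp hc]
      exact ringChar.charP L
    exact aux_charp _ p hpp ho
  · exact aux_not_charp _ p hpp ho hc i hi hf

theorem aux_group {L : Type*} [Field L] [IsAlgClosed L] (G : Subgroup (L ≃+* L))
    (hG : Finite G) : Nat.card G = 1 ∨ Nat.card G = 2 := by
  obtain ⟨i, hi⟩ := IsAlgClosed.exists_pow_nat_eq (-1 : L) (n := 2) (by norm_num)
  have hmem : ∀ g : L ≃+* L, g i ∈ ({i, -i} : Set L) := by
    intro g
    have : (g i) ^ 2 = i ^ 2 := by rw [← map_pow, hi]; simp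
    simpa using sq_eq_sq_iff_eq_or_eq_neg.1 this
  have inj : Function.Injective (fun g : G => (⟨(g : L ≃+* L) i, hmem g⟩ : ({i, -i} : Set L))) := by
    intro g h hgh
    have hgh : (g : L ≃+* L) i = (h : L ≃+* L) i := congrArg Subtype.val hgh
    have hfin : IsOfFinOrder (h⁻¹ * g) := isOfFinOrder_of_finite _
    have hfin' : IsOfFinOrder ((h⁻¹ * g : G) : L ≃+* L) := Submonoid.isOfFinOrder_coe.2 hfin
    have := aux_main _ hfin' i hi (by
      change (h : L ≃+* L).symm ((g : L ≃+* L) i) = i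
      rw [hgh]; simp)
    have h2 : h⁻¹ * g = 1 := Subtype.ext this
    exact (inv_mul_eq_one.1 h2).symm
  have h1 := Nat.card_le_card_of_injective _ inj
  have h2 : Nat.card ({i, -i} : Set L) ≤ 2 := by
    rw [Nat.card_coe_set_eq]
    exact (Set.ncard_insert_le _ _).trans (by simp)
  have h3 : 0 < Nat.card G := Nat.card_pos
  have h4 := h1.trans h2
  omega

/-- There is no field automorphism of order 3 of an algebraically closed field; more
generally (Artin–Schreier), any finite subgroup of the automorphism group of an
algebraically closed field has order 1 or 2. -/
theorem stmt_10 (L : Type*) [Field L] [IsAlgClosed L] :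
    (∀ σ : L ≃+* L, orderOf σ ≠ 3) ∧
    (∀ G : Subgroup (L ≃+* L), Finite G → Nat.card G = 1 ∨ Nat.card G = 2) := by
  refine ⟨fun σ h => ?_, fun G hG => aux_group G hG⟩
  have hc : Nat.card (Subgroup.zpowers σ) = 3 := by rw [Nat.card_zpowers, h]
  have hf : Finite (Subgroup.zpowers σ) := Nat.finite_of_card_ne_zero (by omega)
  have := aux_group _ hf
  omega
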